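/- For all 1 ≤ i < j ≤ n, the element a_{i,j} := y_{i,j}^2 is central in E_n^!, i.e., y_{i,j}^2 commutes with every element of E_n^!. -/

import Mathlib

/- The quadratic dual Fomin–Kirillov algebra `E_n^!` over an algebraically
closed field `k` of characteristic zero, presented as a quotient of the free
algebra on generators `y_{i,j}` (for `1 ≤ i < j ≤ n`, realized here with
`0`-based indexing by the subtype of pairs `(i,j) : Fin n × Fin n` with `i < j`),
with the convention `y_{j,i} = -y_{i,j}`. -/

noncomputable section

variable (k : Type) [Field k] [IsAlgClosed k] [CharZero k]

/-- Index set for the generators: pairs `(i,j)` with `i < j`. -/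
abbrev FKIdx (n : ℕ) := {p : Fin n × Fin n // p.1 < p.2}

/-- The element `y_{i,j}` of the free algebra, with the convention
`y_{j,i} = -y_{i,j}` (and `y_{i,i} = 0`, which is never used). -/
def Ygen (n : ℕ) (i j : Fin n) : FreeAlgebra k (FKIdx n) :=
  if h : i < j then FreeAlgebra.ι k ⟨(i, j), h⟩
  else if h' : j < i then - FreeAlgebra.ι k ⟨(j, i), h'⟩
  else 0

/-- The defining relations of `E_n^!`. -/
inductive FKRel (n : ℕ) : FreeAlgebra k (FKIdx n) → FreeAlgebra k (FKIdx n) → Prop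
  | triple (i j l : Fin n) (hij : i ≠ j) (hjl : j ≠ l) (hil : i ≠ l) :
      FKRel n (Ygen k n i j * Ygen k n j l + Ygen k n j l * Ygen k n i l) 0
  | disj (i j s t : Fin n) (hij : i < j) (hst : s < t)
      (h1 : i ≠ s) (h2 : i ≠ t) (h3 : j ≠ s) (h4 : j ≠ t) :
      FKRel n (Ygen k n i j * Ygen k n s t + Ygen k n s t * Ygen k n i j) 0

/-- The quadratic dual Fomin–Kirillov algebra `E_n^!`. -/
abbrev FKDual (n : ℕ) := RingQuot (FKRel k n)

/-- The generator `y_{i,j}` of `E_n^!`. -/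
def yy (n : ℕ) (i j : Fin n) : FKDual k n :=
  RingQuot.mkAlgHom k (FKRel k n) (Ygen k n i j)

theorem yy_anti (n : ℕ) (i j : Fin n) : yy k n i j = - yy k n j i := by
  unfold yy
  rw [← map_neg]
  congr 1
  unfold Ygen
  rcases lt_trichotomy i j with h | h | h
  · simp [h, h.not_gt]
  · simp [h]
  · simp [h, h.not_gt]

theorem yy_triple (n : ℕ) (i j l : Fin n) (hij : i ≠ j) (hjl : j ≠ l) (hil : i ≠ l) :
    yy k n i j * yy k n j l = - (yy k n j l * yy k n i l) := by
  have h := RingQuot.mkAlgHom_rel k (FKRel.triple (k := k) i j l hij hjl hil)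
  simp only [map_add, map_mul, map_zero] at h
  exact eq_neg_of_add_eq_zero_left h

theorem yy_disj (n : ℕ) (i j s t : Fin n) (hij : i < j) (hst : s < t)
    (h1 : i ≠ s) (h2 : i ≠ t) (h3 : j ≠ s) (h4 : j ≠ t) :
    yy k n i j * yy k n s t = - (yy k n s t * yy k n i j) := by
  have h := RingQuot.mkAlgHom_rel k (FKRel.disj (k := k) i j s t hij hst h1 h2 h3 h4)
  simp only [map_add, map_mul, map_zero] at h
  exact eq_neg_of_add_eq_zero_left h

/-- If `a b = -c a` and `a c = -b a` then `a ^ 2` commutes with `b`. -/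
theorem sq_comm_aux {R : Type*} [Ring R] (a b c : R) (h1 : a * b = -(c * a))
    (h2 : a * c = -(b * a)) : a ^ 2 * b = b * a ^ 2 := by
  rw [pow_two, mul_assoc, h1, mul_neg, ← mul_assoc, h2, neg_mul, neg_neg, mul_assoc]

theorem ring_share {R : Type*} [Ring R] (a b c a_neg b_neg c_neg : R) (ha : a_neg = -a) (hb : b_neg = -b)
    (hc : c_neg = -c) (h1 : c_neg * a = -(a * b_neg)) (h2 : b_neg * a_neg = -(a_neg * c_neg)) :
    a ^ 2 * b = b * a ^ 2 := by
  subst ha hb hc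
  apply sq_comm_aux _ _ c
  · simp only [neg_mul, mul_neg, neg_neg] at h1
    exact h1.symm
  · simp only [neg_mul, mul_neg, neg_neg] at h2
    rw [h2, neg_neg]

theorem ring_neg_left {R : Type*} [Ring R] (a a_neg b : R) (ha : a_neg = -a)
    (h : a_neg ^ 2 * b = b * a_neg ^ 2) : a ^ 2 * b = b * a ^ 2 := by
  subst ha
  rwa [neg_sq] at h

theorem ring_neg_right {R : Type*} [Ring R] (a b b_neg : R) (hb : b_neg = -b)
    (h : a ^ 2 * b = b * a ^ 2) : a ^ 2 * b_neg = b_neg * a ^ 2 := by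
  subst hb
  rw [mul_neg, neg_mul, h]

theorem yy_share (n : ℕ) (i j l : Fin n) (hij : i ≠ j) (hjl : j ≠ l) (hil : i ≠ l) :
    yy k n i j ^ 2 * yy k n j l = yy k n j l * yy k n i j ^ 2 :=
  ring_share (yy k n i j) (yy k n j l) (yy k n i l) (yy k n j i) (yy k n l j) (yy k n l i)
    (yy_anti k n j i) (yy_anti k n l j) (yy_anti k n l i)
    (yy_triple k n l i j hil.symm hij hjl.symm) (yy_triple k n l j i hjl.symm hij.symm hil.symm)

theorem yy_share_left (n : ℕ) (i j l : Fin n) (hij : i ≠ j) (hjl : j ≠ l) (hil : i ≠ l) :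
    yy k n i j ^ 2 * yy k n i l = yy k n i l * yy k n i j ^ 2 :=
  ring_neg_left _ _ _ (yy_anti k n j i) (yy_share k n j i l hij.symm hil hjl)

theorem yy_sq_gen (n : ℕ) (i j s t : Fin n) (hij : i < j) (hst : s < t) :
    yy k n i j ^ 2 * yy k n s t = yy k n s t * yy k n i j ^ 2 := by
  by_cases h1 : i = s
  · subst h1
    by_cases h4 : j = t
    · subst h4
      rw [← pow_succ, ← pow_succ']
    · exact yy_share_left k n i j t hij.ne h4 hst.ne
  by_cases h4 : j = t
  · subst h4
    have h := yy_share k n i j s hij.ne hst.ne' h1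
    exact ring_neg_right _ _ _ (yy_anti k n s j) h
  by_cases h2 : i = t
  · subst h2
    have h := yy_share_left k n i j s hij.ne (hst.trans hij).ne' h1
    exact ring_neg_right _ _ _ (yy_anti k n s i) h
  by_cases h3 : j = s
  · subst h3
    exact yy_share k n i j t hij.ne hst.ne h2
  have h := yy_disj k n i j s t hij hst h1 h2 h3 h4
  exact sq_comm_aux _ _ _ h h

/-- for all `1 ≤ i < j ≤ n`, the element `a_{i,j} := y_{i,j}^2`
is central in `E_n^!`. -/
theorem FKDual_sq_central (n : ℕ) (hn : 2 ≤ n) (i j : Fin n) (hij : i < j) :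
    ∀ x : FKDual k n, (yy k n i j) ^ 2 * x = x * (yy k n i j) ^ 2 := by
  intro x
  obtain ⟨f, rfl⟩ := RingQuot.mkAlgHom_surjective k (FKRel k n) x
  induction f using FreeAlgebra.induction with
  | grade0 r =>
    rw [AlgHom.commutes]
    exact (Algebra.commutes r _).symm
  | grade1 p =>
    obtain ⟨⟨s, t⟩, hst⟩ := p
    have h := yy_sq_gen k n i j s t hij hst
    have e : yy k n s t = RingQuot.mkAlgHom k (FKRel k n) (FreeAlgebra.ι k ⟨(s, t), hst⟩) := by
      have hst2 : s < t := hst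
      simp [yy, Ygen, hst2]
    rw [e] at h
    exact h
  | mul a b ha hb => rw [map_mul, ← mul_assoc, ha, mul_assoc, hb, mul_assoc]
  | add a b ha hb => rw [map_add, mul_add, add_mul, ha, hb]

end
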